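/- If H and H′ are two directed Huffman trees generated by a tuple ⟨μ,d⟩ with degree-monotone weights (H, H′ ∈ ℛℋ(μ,d)), then VWWI(H) = VWWI(H′). -/

import Mathlib

open scoped Classical
noncomputable section

/-- A directed tree on a finite vertex set `V`: each vertex has an outbound arc to its
`parent`, the `root` is a fixed point of `parent` (i.e. has no genuine outbound arc), and
every vertex reaches the root by iterating `parent`. -/
structure DirTree (V : Type) [Fintype V] [DecidableEq V] where
  root : V
  parent : V → V
  parent_root : parent root = root
  reaches : ∀ v, ∃ n, parent^[n] v = root

variable {V : Type} [Fintype V] [DecidableEq V]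

namespace DirTree

/-- `u` belongs to the subordinate group of `v`: there is a directed path from `u` to `v`. -/
def Desc (T : DirTree V) (u v : V) : Prop := ∃ n, T.parent^[n] u = v

/-- The set of vertices with an arc to `v`. -/
def children (T : DirTree V) (v : V) : Finset V :=
  Finset.univ.filter fun u => T.parent u = v ∧ u ≠ v

/-- Weight `f_T(v)` of the subordinate group of `v`. -/
def f (T : DirTree V) (μ : V → ℝ) (v : V) : ℝ :=
  ∑ u ∈ Finset.univ.filter (fun u => T.Desc u v), μ u

/-- Degree of `v` in the underlying undirected tree. -/
def deg (T : DirTree V) (v : V) : ℕ :=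
  (T.children v).card + (if v = T.root then 0 else 1)

/-- The underlying undirected tree. -/
def toGraph (T : DirTree V) : SimpleGraph V :=
  SimpleGraph.fromRel fun u v => T.parent u = v ∧ u ≠ v

/-- The vector (as a multiset, i.e. up to ascending rearrangement) of subordinate
groups' weights of internal non-root vertices. -/
def fvec (T : DirTree V) (μ : V → ℝ) : Multiset ℝ :=
  (Finset.univ.filter fun m => 1 < T.deg m ∧ m ≠ T.root).val.map (T.f μ)

end DirTree

/-- Degree of a vertex in a simple graph. -/
def gdeg (G : SimpleGraph V) (v : V) : ℕ :=
  (Finset.univ.filter fun u => G.Adj v u).card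

/-- `⟨μ, d⟩` is a generating tuple: nonnegative weights, degrees at least 1 summing to
`2(|V|-1)`, at least two pendent and at least one internal vertex. -/
structure IsGenTuple (μ : V → ℝ) (d : V → ℕ) : Prop where
  nonneg : ∀ v, 0 ≤ μ v
  deg_pos : ∀ v, 1 ≤ d v
  sum_deg : ∑ v, d v = 2 * (Fintype.card V - 1)
  two_le_pendent : 2 ≤ (Finset.univ.filter fun v => d v = 1).card
  one_le_internal : 1 ≤ (Finset.univ.filter fun v => 1 < d v).card

/-- Weights are degree-monotone in `⟨μ, d⟩`. -/
def DegMonotone (μ : V → ℝ) (d : V → ℕ) : Prop :=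
  (∀ m m', 1 < d m → 1 < d m' → d m < d m' → μ m ≤ μ m') ∧
  ∀ v, d v = 1 → 0 < μ v

/-- `T ∈ ℛ(μ,d)`: directed tree with internal root whose (undirected) degrees match `d`. -/
def memR (T : DirTree V) (d : V → ℕ) : Prop :=
  1 < d T.root ∧ ∀ v, T.deg v = d v

/-- `G ∈ 𝒯(μ,d)`: `G` is a tree whose degrees match `d`. -/
def memT (G : SimpleGraph V) (d : V → ℕ) : Prop :=
  G.IsTree ∧ ∀ v, gdeg G v = d v

/-- Vertex-weighted Wiener index. -/
def VWWI (μ : V → ℝ) (G : SimpleGraph V) : ℝ :=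
  (1 / 2) * ∑ u, ∑ v, μ u * μ v * (G.dist u v : ℝ)

/-- `S = (m, L)` is a minimal star for the state `(U, μ, d)`: the center `m` is an
internal vertex of `U` of least degree among internal vertices of least weight, and the
`d m - 1` leaves `L` are pendent vertices of `U` of least weights. -/
def IsMinimalStar (U : Finset V) (μ : V → ℝ) (d : V → ℕ) (m : V) (L : Finset V) : Prop :=
  m ∈ U ∧ 1 < d m ∧ L ⊆ U ∧ m ∉ L ∧ L.card = d m - 1 ∧
  (∀ v ∈ L, d v = 1) ∧
  (∀ m' ∈ U, 1 < d m' → μ m ≤ μ m') ∧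
  (∀ m' ∈ U, 1 < d m' → μ m' = μ m → d m ≤ d m') ∧
  ∀ u ∈ L, ∀ w ∈ U, d w = 1 → w ∉ L → μ u ≤ μ w

/-- Centers used before step `i` (0-indexed). -/
def usedCenters {q : ℕ} (c : Fin q → V) (i : ℕ) : Finset V :=
  (Finset.univ.filter fun j : Fin q => (j : ℕ) < i).image c

/-- Vertex set `V_{i+1}` of the state of the Huffman algorithm before (0-indexed) step `i`,
for the candidate Huffman tree `T` with star centers `c`. -/
def stateV (T : DirTree V) {q : ℕ} (c : Fin q → V) (i : ℕ) : Finset V :=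
  Finset.univ \ (Finset.univ.filter fun j : Fin q => (j : ℕ) < i).biUnion fun j => T.children (c j)

/-- Weight function `μ^{i+1}` of the state before (0-indexed) step `i`. -/
def stateMu (T : DirTree V) (μ : V → ℝ) {q : ℕ} (c : Fin q → V) (i : ℕ) : V → ℝ :=
  fun v => if v ∈ usedCenters c i then T.f μ v else μ v

/-- Degree function `d^{i+1}` of the state before (0-indexed) step `i`. -/
def stateD (d : V → ℕ) {q : ℕ} (c : Fin q → V) (i : ℕ) : V → ℕ :=
  fun v => if v ∈ usedCenters c i then 1 else d v

/-- `T` is a directed Huffman tree for `⟨μ, d⟩` whose star sequence has centers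
`c 0, …, c (q-1)` (so `S_i` has leaf set `children (c i)`): the centers enumerate the
internal vertices, the root is the last center, and at each of the first `q - 1` steps
the corresponding star is a minimal star of the current state. -/
def IsHuffmanSeq (μ : V → ℝ) (d : V → ℕ) (T : DirTree V) {q : ℕ} (c : Fin q → V) : Prop :=
  (∀ v, T.deg v = d v) ∧
  Function.Injective c ∧
  (∀ v, 1 < d v ↔ ∃ j, c j = v) ∧
  (∀ hq : 0 < q, T.root = c ⟨q - 1, Nat.sub_lt hq Nat.one_pos⟩) ∧
  ∀ i : Fin q, (i : ℕ) < q - 1 →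
    IsMinimalStar (stateV T c (i : ℕ)) (stateMu T μ c (i : ℕ)) (stateD d c (i : ℕ))
      (c i) (T.children (c i))

/-- `T ∈ ℛℋ(μ,d)`: `T` is a directed Huffman tree for `⟨μ, d⟩`. -/
def IsHuffmanDir (μ : V → ℝ) (d : V → ℕ) (T : DirTree V) : Prop :=
  ∃ (q : ℕ) (c : Fin q → V), IsHuffmanSeq μ d T c

/-- Sum of the `k` smallest components of a multiset of reals. -/
def ascSum (s : Multiset ℝ) (k : ℕ) : ℝ := ((s.sort (· ≤ ·)).take k).sum

/-- `x` weakly majorizes `y` (`y ⪯^w x`). -/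
def WMaj (x y : Multiset ℝ) : Prop :=
  Multiset.card x = Multiset.card y ∧ ∀ k, ascSum x k ≤ ascSum y k

/-- `x` strictly weakly majorizes `y` (`y ≺^w x`). -/
def SWMaj (x y : Multiset ℝ) : Prop := WMaj x y ∧ x ≠ y

namespace DirTree

lemma iterate_root (T : DirTree V) (n : ℕ) : T.parent^[n] T.root = T.root :=
  Function.iterate_fixed T.parent_root n

lemma eq_root_of_periodic (T : DirTree V) {u : V} {n : ℕ} (hn : 0 < n)
    (h : T.parent^[n] u = u) : u = T.root := by
  obtain ⟨k, hk⟩ := T.reaches u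
  have h1 : T.parent^[n * k] u = u := by
    rw [Function.iterate_mul]
    exact Function.iterate_fixed h k
  have h2 : n * k = (n * k - k) + k := by
    have : k ≤ n * k := Nat.le_mul_of_pos_left k hn
    omega
  rw [h2, Function.iterate_add_apply, hk, iterate_root] at h1
  exact h1.symm

lemma Desc.refl (T : DirTree V) (u : V) : T.Desc u u := ⟨0, rfl⟩

lemma Desc.trans {T : DirTree V} {u v w : V} (h : T.Desc u v) (h' : T.Desc v w) :
    T.Desc u w := by
  obtain ⟨a, rfl⟩ := h
  obtain ⟨b, rfl⟩ := h'
  exact ⟨b + a, Function.iterate_add_apply ..⟩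

lemma Desc.antisymm {T : DirTree V} {u v : V} (h : T.Desc u v) (h' : T.Desc v u) : u = v := by
  obtain ⟨a, ha⟩ := h
  obtain ⟨b, hb⟩ := h'
  rcases Nat.eq_zero_or_pos a with rfl | hpos
  · exact ha
  have hu : u = T.root := T.eq_root_of_periodic (n := b + a) (by omega) (by
    rw [Function.iterate_add_apply, ha, hb])
  rw [← ha, hu, iterate_root]

lemma desc_parent (T : DirTree V) (u : V) : T.Desc u (T.parent u) := ⟨1, rfl⟩

lemma desc_root (T : DirTree V) (u : V) : T.Desc u T.root := T.reaches u

lemma desc_iff (T : DirTree V) (u w : V) : T.Desc u w ↔ w = u ∨ T.Desc (T.parent u) w := by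
  constructor
  · rintro ⟨_ | n, h⟩
    · exact Or.inl h.symm
    · exact Or.inr ⟨n, by rwa [Function.iterate_succ_apply] at h⟩
  · rintro (rfl | h)
    · exact Desc.refl T _
    · exact (T.desc_parent u).trans h

lemma Desc.comparable {T : DirTree V} {u v w : V} (h : T.Desc u v) (h' : T.Desc u w) :
    T.Desc v w ∨ T.Desc w v := by
  obtain ⟨a, rfl⟩ := h
  obtain ⟨b, rfl⟩ := h'
  rcases le_total a b with hab | hab
  · exact Or.inl ⟨b - a, by rw [← Function.iterate_add_apply, Nat.sub_add_cancel hab]⟩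
  · exact Or.inr ⟨a - b, by rw [← Function.iterate_add_apply, Nat.sub_add_cancel hab]⟩

lemma mem_children {T : DirTree V} {u v : V} : u ∈ T.children v ↔ T.parent u = v ∧ u ≠ v := by
  simp [children]

lemma f_root (T : DirTree V) (μ : V → ℝ) : T.f μ T.root = ∑ v, μ v := by
  simp [f, desc_root]

lemma f_eq_add_sum_children (T : DirTree V) (μ : V → ℝ) (v : V) :
    T.f μ v = μ v + ∑ u ∈ T.children v, T.f μ u := by
  have hset : (Finset.univ.filter fun u => T.Desc u v) =
      insert v ((T.children v).biUnion fun c => Finset.univ.filter fun u => T.Desc u c) := by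
    ext u
    simp only [Finset.mem_filter, Finset.mem_univ, true_and, Finset.mem_insert,
      Finset.mem_biUnion, mem_children]
    constructor
    · rintro ⟨n, hn⟩
      induction n generalizing u with
      | zero => exact Or.inl hn
      | succ n ih =>
        rw [Function.iterate_succ_apply] at hn
        by_cases huv : u = v
        · exact Or.inl huv
        rcases ih _ hn with h | ⟨c, hc, hd⟩
        · exact Or.inr ⟨u, ⟨h, huv⟩, Desc.refl T u⟩
        · exact Or.inr ⟨c, hc, (T.desc_parent u).trans hd⟩
    · rintro (rfl | ⟨c, hc, hd⟩)
      · exact Desc.refl T _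
      · exact hd.trans (hc.1 ▸ T.desc_parent c)
  have hnot : ∀ {a b : V}, a ∈ T.children v → b ∈ T.children v → T.Desc a b → a = b := by
    intro a b ha hb hab
    rw [mem_children] at ha hb
    rcases (T.desc_iff a b).1 hab with h | h
    · exact h.symm
    · exact absurd (Desc.antisymm (hb.1 ▸ T.desc_parent b) (ha.1 ▸ h)) hb.2
  unfold f
  rw [hset, Finset.sum_insert, Finset.sum_biUnion]
  · intro a ha b hb hab
    rw [Function.onFun, Finset.disjoint_left]
    intro u hua hub
    simp only [Finset.mem_filter, Finset.mem_univ, true_and] at hua hub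
    rcases hua.comparable hub with h | h
    · exact hab (hnot ha hb h)
    · exact hab (hnot hb ha h).symm
  · simp only [Finset.mem_biUnion, Finset.mem_filter, Finset.mem_univ, true_and, mem_children,
      not_exists, not_and]
    intro c hc hd
    exact hc.2 (Desc.antisymm (hc.1 ▸ T.desc_parent c) hd)

lemma f_eq_of_deg_eq_one {T : DirTree V} (μ : V → ℝ) {v : V} (hv : v ≠ T.root)
    (h : T.deg v = 1) : T.f μ v = μ v := by
  have : T.children v = ∅ := by
    rw [← Finset.card_eq_zero]
    simpa [deg, hv] using h
  rw [f_eq_add_sum_children, this, Finset.sum_empty, add_zero]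

/-- The vertices on the directed path from `u` to the root. -/
def ancestors (T : DirTree V) (u : V) : Finset V :=
  Finset.univ.filter fun w => T.Desc u w

lemma mem_ancestors {T : DirTree V} {u w : V} : w ∈ T.ancestors u ↔ T.Desc u w := by
  simp [ancestors]

lemma toGraph_adj {T : DirTree V} {u v : V} :
    T.toGraph.Adj u v ↔ u ≠ v ∧ (T.parent u = v ∨ T.parent v = u) := by
  simp only [toGraph, SimpleGraph.fromRel_adj]
  grind

lemma ancestors_eq_insert (T : DirTree V) (u : V) :
    T.ancestors u = insert u (T.ancestors (T.parent u)) := by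
  ext w
  simp only [Finset.mem_insert, mem_ancestors]
  exact T.desc_iff u w

lemma card_symmDiff_ancestors_le {T : DirTree V} {u v : V} (p : T.toGraph.Walk u v) :
    (symmDiff (T.ancestors u) (T.ancestors v)).card ≤ p.length := by
  induction p with
  | nil => simp
  | @cons u w v h p ih =>
    have hone : (symmDiff (T.ancestors u) (T.ancestors w)).card ≤ 1 := by
      rcases (toGraph_adj.1 h).2 with h | h
      · refine (Finset.card_le_card (t := {u}) ?_).trans_eq (Finset.card_singleton u)
        rw [T.ancestors_eq_insert u, h]
        intro x
        simp only [Finset.mem_symmDiff, Finset.mem_insert, Finset.mem_singleton]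
        tauto
      · refine (Finset.card_le_card (t := {w}) ?_).trans_eq (Finset.card_singleton w)
        rw [T.ancestors_eq_insert w, h]
        intro x
        simp only [Finset.mem_symmDiff, Finset.mem_insert, Finset.mem_singleton]
        tauto
    calc (symmDiff (T.ancestors u) (T.ancestors v)).card
        ≤ (symmDiff (T.ancestors u) (T.ancestors w) ∪
            symmDiff (T.ancestors w) (T.ancestors v)).card :=
          Finset.card_le_card (symmDiff_triangle _ _ _)
      _ ≤ _ := Finset.card_union_le _ _
      _ ≤ _ := by rw [SimpleGraph.Walk.length_cons]; omega

lemma card_symmDiff_parent {T : DirTree V} {u v : V} (h : ¬ T.Desc v u) :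
    (symmDiff (T.ancestors u) (T.ancestors v)).card =
      (symmDiff (T.ancestors (T.parent u)) (T.ancestors v)).card + 1 := by
  have hpu : ¬ T.Desc (T.parent u) u := fun hd => by
    have hroot : u = T.root := by
      obtain ⟨n, hn⟩ := hd
      exact T.eq_root_of_periodic n.succ_pos (by rwa [Function.iterate_succ_apply])
    exact h (hroot ▸ T.desc_root v)
  have hu : u ∉ symmDiff (T.ancestors (T.parent u)) (T.ancestors v) := by
    simp [Finset.mem_symmDiff, mem_ancestors, h, hpu]
  rw [← Finset.card_insert_of_notMem hu, T.ancestors_eq_insert u]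
  congr 1
  ext x
  by_cases hx : x = u
  · subst hx
    simp [Finset.mem_symmDiff, mem_ancestors, h]
  · simp [Finset.mem_symmDiff, hx]

lemma exists_walk (T : DirTree V) (u v : V) :
    ∃ p : T.toGraph.Walk u v,
      p.length ≤ (symmDiff (T.ancestors u) (T.ancestors v)).card := by
  induction hk : (symmDiff (T.ancestors u) (T.ancestors v)).card generalizing u v with
  | zero =>
    rw [Finset.card_eq_zero] at hk
    have h : T.ancestors u = T.ancestors v := symmDiff_eq_bot.1 hk
    have h1 : T.Desc u v := mem_ancestors.1 (h ▸ mem_ancestors.2 (Desc.refl T v))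
    have h2 : T.Desc v u := mem_ancestors.1 (h ▸ mem_ancestors.2 (Desc.refl T u))
    obtain rfl := h1.antisymm h2
    exact ⟨.nil, le_rfl⟩
  | succ k ih =>
    have adj : ∀ {a b : V}, ¬ T.Desc b a → T.toGraph.Adj a (T.parent a) := by
      intro a b h
      refine toGraph_adj.2 ⟨fun ha => h ?_, Or.inl rfl⟩
      have := T.eq_root_of_periodic (u := a) (n := 1) one_pos ha.symm
      exact this ▸ T.desc_root b
    by_cases h : T.Desc v u
    · by_cases h' : T.Desc u v
      · obtain rfl := h.antisymm h'
        simp at hk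
      · rw [symmDiff_comm, card_symmDiff_parent h'] at hk
        obtain ⟨p, hp⟩ := ih u (T.parent v) (by rw [symmDiff_comm]; omega)
        exact ⟨p.concat (adj h').symm, by rw [SimpleGraph.Walk.length_concat]; omega⟩
    · rw [card_symmDiff_parent h] at hk
      obtain ⟨p, hp⟩ := ih (T.parent u) v (by omega)
      exact ⟨.cons (adj h) p, by rw [SimpleGraph.Walk.length_cons]; omega⟩

lemma dist_toGraph (T : DirTree V) (u v : V) :
    T.toGraph.dist u v = (symmDiff (T.ancestors u) (T.ancestors v)).card := by
  obtain ⟨p, hp⟩ := T.exists_walk u v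
  apply le_antisymm ((SimpleGraph.dist_le p).trans hp)
  obtain ⟨r, hr⟩ := p.reachable.exists_walk_length_eq_dist
  exact hr ▸ card_symmDiff_ancestors_le r

lemma VWWI_toGraph (T : DirTree V) (μ : V → ℝ) :
    VWWI μ T.toGraph = ∑ w, T.f μ w * ((∑ v, μ v) - T.f μ w) := by
  have hcard : ∀ u v : V, (T.toGraph.dist u v : ℝ) =
      ∑ w, ((if T.Desc u w then (1 : ℝ) else 0) * (1 - if T.Desc v w then 1 else 0) +
        (1 - if T.Desc u w then (1 : ℝ) else 0) * (if T.Desc v w then 1 else 0)) := by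
    intro u v
    have hsum : ∀ s : Finset V, (s.card : ℝ) = ∑ w, if w ∈ s then 1 else 0 := by simp
    rw [dist_toGraph, hsum]
    refine Finset.sum_congr rfl fun w _ => ?_
    by_cases h1 : T.Desc u w <;> by_cases h2 : T.Desc v w <;>
      simp [Finset.mem_symmDiff, mem_ancestors, h1, h2]
  have hf : ∀ w, T.f μ w = ∑ u, μ u * (if T.Desc u w then (1 : ℝ) else 0) := by
    intro w
    simp [f, Finset.sum_filter]
  have hsub : ∀ w, (∑ v, μ v) - T.f μ w =
      ∑ u, μ u * (1 - if T.Desc u w then (1 : ℝ) else 0) := by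
    intro w
    rw [hf, ← Finset.sum_sub_distrib]
    exact Finset.sum_congr rfl fun u _ => by ring
  have hw : ∀ w, ∑ u, ∑ v, μ u * μ v *
      ((if T.Desc u w then (1 : ℝ) else 0) * (1 - if T.Desc v w then 1 else 0) +
        (1 - if T.Desc u w then (1 : ℝ) else 0) * (if T.Desc v w then 1 else 0)) =
      2 * (T.f μ w * ((∑ v, μ v) - T.f μ w)) := by
    intro w
    rw [two_mul]
    nth_rewrite 2 [mul_comm]
    rw [hsub, hf, Finset.sum_mul_sum, Finset.sum_mul_sum, ← Finset.sum_add_distrib]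
    refine Finset.sum_congr rfl fun u _ => ?_
    rw [← Finset.sum_add_distrib]
    exact Finset.sum_congr rfl fun v _ => by ring
  have hsum : ∑ u, ∑ v, μ u * μ v * (T.toGraph.dist u v : ℝ) =
      2 * ∑ w, T.f μ w * ((∑ v, μ v) - T.f μ w) := by
    simp_rw [hcard, Finset.mul_sum, ← hw]
    rw [Finset.sum_congr rfl fun u _ => Finset.sum_comm, Finset.sum_comm]
  rw [VWWI, hsum]
  ring

end DirTree

/-- Sub-multisets of smallest elements are determined by their cardinality. -/
lemma Multiset.eq_of_add_eq_add_of_le {α : Type*} [LinearOrder α] {A B C D : Multiset α}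
    (h : A + B = C + D) (hcard : A.card = C.card)
    (hA : ∀ a ∈ A, ∀ b ∈ B, a ≤ b) (hC : ∀ a ∈ C, ∀ b ∈ D, a ≤ b) : A = C := by
  have sorted : ∀ {A B : Multiset α}, (∀ a ∈ A, ∀ b ∈ B, a ≤ b) →
      (A.sort (· ≤ ·) ++ B.sort (· ≤ ·)).Pairwise (· ≤ ·) := by
    intro A B hAB
    rw [List.pairwise_append]
    exact ⟨A.pairwise_sort _, B.pairwise_sort _, fun a ha b hb =>
      hAB a (by simpa using ha) b (by simpa using hb)⟩
  have hperm : (A.sort (· ≤ ·) ++ B.sort (· ≤ ·)).Perm (C.sort (· ≤ ·) ++ D.sort (· ≤ ·)) := by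
    rw [← Multiset.coe_eq_coe, ← Multiset.coe_add, ← Multiset.coe_add]
    simpa using h
  have heq := hperm.eq_of_pairwise' (sorted hA) (sorted hC)
  have := (List.append_inj heq (by simpa using hcard)).1
  rw [← A.sort_eq (· ≤ ·), this, C.sort_eq]

/-- The multiset of weights of the pendent vertices of a state. -/
def pendentWeights (U : Finset V) (μ : V → ℝ) (d : V → ℕ) : Multiset ℝ :=
  (U.filter fun v => d v = 1).val.map μ

/-- The multiset of weights and degrees of the internal vertices of a state. -/
def internalData (U : Finset V) (μ : V → ℝ) (d : V → ℕ) : Multiset (ℝ × ℕ) :=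
  (U.filter fun v => 1 < d v).val.map fun v => (μ v, d v)

lemma mem_internalData {U : Finset V} {μ : V → ℝ} {d : V → ℕ} {x : ℝ × ℕ} :
    x ∈ internalData U μ d ↔ ∃ v ∈ U, 1 < d v ∧ (μ v, d v) = x := by
  simp [internalData, and_assoc]

namespace IsMinimalStar

variable {U U' : Finset V} {μ μ' : V → ℝ} {d d' : V → ℕ} {m m' : V} {L L' : Finset V}

lemma pendentWeights_eq (h : IsMinimalStar U μ d m L) :
    pendentWeights U μ d =
      L.val.map μ + ((U.filter fun v => d v = 1) \ L).val.map μ := by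
  obtain ⟨-, -, hLU, -, -, hL1, -⟩ := h
  have hsub : L ⊆ U.filter fun v => d v = 1 := fun v hv =>
    Finset.mem_filter.2 ⟨hLU hv, hL1 v hv⟩
  rw [pendentWeights, Finset.sdiff_val, ← Multiset.map_add,
    add_tsub_cancel_of_le (Finset.val_le_iff.2 hsub)]

/-- The weight and degree of the center of a minimal star depend only on `internalData`. -/
lemma center_eq (h : IsMinimalStar U μ d m L) (h' : IsMinimalStar U' μ' d' m' L')
    (hI : internalData U μ d = internalData U' μ' d') : μ m = μ' m' ∧ d m = d' m' := by
  obtain ⟨hmU, hm1, -, -, -, -, hle, hdeg, -⟩ := h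
  obtain ⟨hmU', hm1', -, -, -, -, hle', hdeg', -⟩ := h'
  obtain ⟨a, haU, ha1, ha⟩ := mem_internalData.1 (hI ▸ mem_internalData.2 ⟨m, hmU, hm1, rfl⟩)
  obtain ⟨b, hbU, hb1, hb⟩ := mem_internalData.1 (hI ▸ mem_internalData.2 ⟨m', hmU', hm1', rfl⟩)
  rw [Prod.mk.injEq] at ha hb
  have hμ : μ m = μ' m' := le_antisymm (hb.1 ▸ hle b hbU hb1) (ha.1 ▸ hle' a haU ha1)
  refine ⟨hμ, le_antisymm ?_ ?_⟩
  · exact hb.2 ▸ hdeg b hbU hb1 (by rw [hb.1, hμ])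
  · exact ha.2 ▸ hdeg' a haU ha1 (by rw [ha.1, hμ])

/-- The leaf weights of a minimal star depend only on the two multisets of the state. -/
lemma leaves_eq (h : IsMinimalStar U μ d m L) (h' : IsMinimalStar U' μ' d' m' L')
    (hI : internalData U μ d = internalData U' μ' d')
    (hP : pendentWeights U μ d = pendentWeights U' μ' d') :
    L.val.map μ = L'.val.map μ' := by
  have hd := (h.center_eq h' hI).2
  have least : ∀ {U : Finset V} {μ : V → ℝ} {d : V → ℕ} {m : V} {L : Finset V},
      IsMinimalStar U μ d m L → ∀ a ∈ L.val.map μ,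
        ∀ b ∈ ((U.filter fun v => d v = 1) \ L).val.map μ, a ≤ b := by
    rintro U μ d m L ⟨-, -, -, -, -, -, -, -, hmin⟩ a ha b hb
    obtain ⟨u, hu, rfl⟩ := Multiset.mem_map.1 ha
    obtain ⟨w, hw, rfl⟩ := Multiset.mem_map.1 hb
    simp only [Finset.mem_val, Finset.mem_sdiff, Finset.mem_filter] at hu hw
    exact hmin u hu w hw.1.1 hw.1.2 hw.2
  refine Multiset.eq_of_add_eq_add_of_le
    (h.pendentWeights_eq.symm.trans (hP.trans h'.pendentWeights_eq)) ?_ (least h) (least h')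
  obtain ⟨-, -, -, -, hc, -⟩ := h
  obtain ⟨-, -, -, -, hc', -⟩ := h'
  rw [Multiset.card_map, Multiset.card_map, Finset.card_val, Finset.card_val, hc, hc', hd]

variable {μ₁ : V → ℝ} {d₁ : V → ℕ}

/-- Effect of contracting a minimal star on the pendent weights. -/
lemma pendentWeights_step (h : IsMinimalStar U μ d m L) (hμ : ∀ v, v ≠ m → μ₁ v = μ v)
    (hdm : d₁ m = 1) (hd : ∀ v, v ≠ m → d₁ v = d v) :
    L.val.map μ + pendentWeights (U \ L) μ₁ d₁ = μ₁ m ::ₘ pendentWeights U μ d := by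
  have hset : ((U \ L).filter fun v => d₁ v = 1) =
      insert m ((U.filter fun v => d v = 1) \ L) := by
    ext v
    obtain ⟨hmU, -, -, hmL, -⟩ := h
    by_cases hv : v = m
    · subst hv; simp [hmU, hmL, hdm]
    · simp only [Finset.mem_filter, Finset.mem_sdiff, Finset.mem_insert, hv, false_or, hd v hv]
      tauto
  have hm : m ∉ (U.filter fun v => d v = 1) \ L := by
    have := h.2.1
    simp only [Finset.mem_sdiff, Finset.mem_filter]
    omega
  rw [h.pendentWeights_eq, pendentWeights, hset, Finset.insert_val_of_notMem hm,
    Multiset.map_cons, Multiset.add_cons]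
  congr 2
  refine Multiset.map_congr rfl fun v hv => hμ v fun hvm => hm (hvm ▸ hv)

/-- Effect of contracting a minimal star on the internal data. -/
lemma internalData_step (h : IsMinimalStar U μ d m L) (hμ : ∀ v, v ≠ m → μ₁ v = μ v)
    (hdm : d₁ m = 1) (hd : ∀ v, v ≠ m → d₁ v = d v) :
    (μ m, d m) ::ₘ internalData (U \ L) μ₁ d₁ = internalData U μ d := by
  obtain ⟨hmU, hm1, -, hmL, -, hL1, -⟩ := h
  have hm : m ∉ (U \ L).filter fun v => 1 < d₁ v := by simp [hdm]
  have hset : (U.filter fun v => 1 < d v) = insert m ((U \ L).filter fun v => 1 < d₁ v) := by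
    ext v
    by_cases hv : v = m
    · subst hv; simp [hmU, hm1]
    · simp only [Finset.mem_filter, Finset.mem_sdiff, Finset.mem_insert, hv, false_or, hd v hv]
      have := hL1 v
      grind
  rw [internalData, internalData, hset, Finset.insert_val_of_notMem hm, Multiset.map_cons]
  congr 1
  refine Multiset.map_congr rfl fun v hv => ?_
  have hvm : v ≠ m := fun hvm => hm (hvm ▸ hv)
  rw [hμ v hvm, hd v hvm]

end IsMinimalStar

section HuffmanSeq

variable {μ : V → ℝ} {d : V → ℕ} {T : DirTree V} {q : ℕ} {c : Fin q → V}

lemma mem_usedCenters {i : ℕ} {v : V} :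
    v ∈ usedCenters c i ↔ ∃ j : Fin q, (j : ℕ) < i ∧ c j = v := by
  simp [usedCenters]

lemma stateV_succ (i : Fin q) : stateV T c (i + 1) = stateV T c i \ T.children (c i) := by
  ext v
  simp only [stateV, Finset.mem_sdiff, Finset.mem_univ, Finset.mem_biUnion, Finset.mem_filter,
    true_and, not_exists, not_and, Nat.lt_succ_iff]
  constructor
  · exact fun h => ⟨fun j hj => h j hj.le, h i le_rfl⟩
  · rintro ⟨h, h'⟩ j hj
    rcases hj.lt_or_eq with hj | hj
    · exact h j hj
    · rwa [Fin.ext hj]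

lemma mem_usedCenters_succ_self (i : Fin q) : c i ∈ usedCenters c (i + 1) :=
  mem_usedCenters.2 ⟨i, Nat.lt_succ_self _, rfl⟩

lemma mem_usedCenters_succ_of_ne (i : Fin q) {v : V} (hv : v ≠ c i) :
    v ∈ usedCenters c (i + 1) ↔ v ∈ usedCenters c i := by
  simp only [mem_usedCenters]
  constructor
  · rintro ⟨j, hj, rfl⟩
    rcases (Nat.lt_succ_iff.1 hj).lt_or_eq with hj | hj
    · exact ⟨j, hj, rfl⟩
    · exact absurd (congrArg c (Fin.ext hj)) hv
  · rintro ⟨j, hj, rfl⟩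
    exact ⟨j, by omega, rfl⟩

lemma stateMu_succ_of_ne (i : Fin q) {v : V} (hv : v ≠ c i) :
    stateMu T μ c (i + 1) v = stateMu T μ c i v := by
  simp only [stateMu, mem_usedCenters_succ_of_ne i hv]

lemma stateD_succ_of_ne (i : Fin q) {v : V} (hv : v ≠ c i) :
    stateD d c (i + 1) v = stateD d c i v := by
  simp only [stateD, mem_usedCenters_succ_of_ne i hv]

lemma stateMu_succ_self (i : Fin q) : stateMu T μ c (i + 1) (c i) = T.f μ (c i) :=
  if_pos (mem_usedCenters_succ_self i)

lemma stateD_succ_self (i : Fin q) : stateD d c (i + 1) (c i) = 1 :=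
  if_pos (mem_usedCenters_succ_self i)

namespace IsHuffmanSeq

lemma one_lt_deg_root (h : IsHuffmanSeq μ d T c) (hq : 0 < q) : 1 < d T.root :=
  (h.2.2.1 _).2 ⟨_, (h.2.2.2.1 hq).symm⟩

lemma f_eq_of_pendent (h : IsHuffmanSeq μ d T c) (hq : 0 < q) {v : V} (hv : d v = 1) :
    T.f μ v = μ v := by
  refine DirTree.f_eq_of_deg_eq_one μ (fun hr => ?_) ((h.1 v).trans hv)
  have := h.one_lt_deg_root hq
  rw [← hr, hv] at this
  exact lt_irrefl _ this

lemma f_center_eq (h : IsHuffmanSeq μ d T c) (i : Fin q) (hi : (i : ℕ) < q - 1) :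
    T.f μ (c i) = stateMu T μ c i (c i) +
      ((T.children (c i)).val.map (stateMu T μ c i)).sum := by
  have hunused : c i ∉ usedCenters c i := fun hmem => by
    obtain ⟨j, hj, hji⟩ := mem_usedCenters.1 hmem
    exact absurd (congrArg Fin.val (h.2.1 hji)) hj.ne
  rw [DirTree.f_eq_add_sum_children, stateMu, if_neg hunused]
  congr 1
  refine Finset.sum_congr rfl fun u hu => ?_
  have hdu := (h.2.2.2.2 i hi).2.2.2.2.2.1 u hu
  by_cases huc : u ∈ usedCenters c i
  · rw [stateMu, if_pos huc]
  · rw [stateD, if_neg huc] at hdu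
    rw [stateMu, if_neg huc, h.f_eq_of_pendent (by omega) hdu]

lemma card_internal (h : IsHuffmanSeq μ d T c) :
    q = (Finset.univ.filter fun v => 1 < d v).card := by
  have : (Finset.univ.filter fun v => 1 < d v) = Finset.univ.image c := by
    ext v
    simp [h.2.2.1 v]
  rw [this, Finset.card_image_of_injective _ h.2.1, Finset.card_univ, Fintype.card_fin]

variable {T' : DirTree V} {c' : Fin q → V}

/-- The multisets of the states agree along any two runs of the Huffman algorithm. -/
lemma state_eq (h : IsHuffmanSeq μ d T c) (h' : IsHuffmanSeq μ d T' c') (i : ℕ)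
    (hi : i ≤ q - 1) :
    pendentWeights (stateV T c i) (stateMu T μ c i) (stateD d c i) =
        pendentWeights (stateV T' c' i) (stateMu T' μ c' i) (stateD d c' i) ∧
      internalData (stateV T c i) (stateMu T μ c i) (stateD d c i) =
        internalData (stateV T' c' i) (stateMu T' μ c' i) (stateD d c' i) := by
  induction i with
  | zero =>
    have hV : ∀ (S : DirTree V) (e : Fin q → V), stateV S e 0 = Finset.univ := by
      intro S e; simp [stateV]
    have hM : ∀ (S : DirTree V) (e : Fin q → V), stateMu S μ e 0 = μ := by
      intro S e; funext v; simp [stateMu, usedCenters]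
    have hD : ∀ (e : Fin q → V), stateD d e 0 = d := by
      intro e; funext v; simp [stateD, usedCenters]
    simp only [hV, hM, hD, and_self]
  | succ i ih =>
    obtain ⟨hP, hI⟩ := ih (by omega)
    let k : Fin q := ⟨i, by omega⟩
    have hk : (k : ℕ) < q - 1 := hi
    have hs := h.2.2.2.2 k hk
    have hs' := h'.2.2.2.2 k hk
    have hc := hs.center_eq hs' hI
    have hL := hs.leaves_eq hs' hI hP
    have hf : T.f μ (c k) = T'.f μ (c' k) := by
      rw [h.f_center_eq k hk, h'.f_center_eq k hk, hc.1, hL]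
    have hP1 := hs.pendentWeights_step (fun v => stateMu_succ_of_ne (T := T) (μ := μ) k)
      (stateD_succ_self (d := d) k) (fun v => stateD_succ_of_ne k)
    have hP1' := hs'.pendentWeights_step (fun v => stateMu_succ_of_ne (T := T') (μ := μ) k)
      (stateD_succ_self (d := d) k) (fun v => stateD_succ_of_ne k)
    have hI1 := hs.internalData_step (fun v => stateMu_succ_of_ne (T := T) (μ := μ) k)
      (stateD_succ_self (d := d) k) (fun v => stateD_succ_of_ne k)
    have hI1' := hs'.internalData_step (fun v => stateMu_succ_of_ne (T := T') (μ := μ) k)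
      (stateD_succ_self (d := d) k) (fun v => stateD_succ_of_ne k)
    rw [← stateV_succ, stateMu_succ_self] at hP1 hP1'
    rw [← stateV_succ] at hI1 hI1'
    constructor
    · apply add_left_cancel (a := (T.children (c k)).val.map (stateMu T μ c k))
      refine hP1.trans ?_
      rw [hL]
      refine Eq.trans ?_ hP1'.symm
      rw [hf]
      exact congrArg _ hP
    · refine (Multiset.cons_inj_right _).1 (hI1.trans (hI.trans ?_))
      rw [hc.1, hc.2]
      exact hI1'.symm

lemma f_center_eq_f_center (h : IsHuffmanSeq μ d T c) (h' : IsHuffmanSeq μ d T' c')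
    (i : Fin q) : T.f μ (c i) = T'.f μ (c' i) := by
  have hq : 0 < q := i.pos
  by_cases hi : (i : ℕ) < q - 1
  · obtain ⟨hP, hI⟩ := h.state_eq h' i hi.le
    have hs := h.2.2.2.2 i hi
    have hs' := h'.2.2.2.2 i hi
    rw [h.f_center_eq i hi, h'.f_center_eq i hi, (hs.center_eq hs' hI).1,
      hs.leaves_eq hs' hI hP]
  · have hlast : i = ⟨q - 1, Nat.sub_lt hq Nat.one_pos⟩ := Fin.ext (by simp only; omega)
    rw [hlast, ← h.2.2.2.1 hq, ← h'.2.2.2.1 hq, DirTree.f_root, DirTree.f_root]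

lemma sum_eq (h : IsHuffmanSeq μ d T c) (hq : 0 < q) (hd : ∀ v, 1 ≤ d v) (g : ℝ → ℝ) :
    ∑ v, g (T.f μ v) =
      ∑ i, g (T.f μ (c i)) + ∑ v ∈ Finset.univ.filter (fun v => ¬ 1 < d v), g (μ v) := by
  have himg : (Finset.univ.filter fun v => 1 < d v) = Finset.univ.image c := by
    ext v
    simp [h.2.2.1 v]
  rw [← Finset.sum_filter_add_sum_filter_not Finset.univ (fun v => 1 < d v), himg,
    Finset.sum_image h.2.1.injOn]
  congr 1
  refine Finset.sum_congr rfl fun v hv => ?_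
  have := hd v
  rw [h.f_eq_of_pendent hq (by have := (Finset.mem_filter.1 hv).2; omega)]

end IsHuffmanSeq

end HuffmanSeq

/-- any two directed Huffman trees of a degree-monotone generating tuple
have the same vertex-weighted Wiener index. -/
theorem huffman_VWWI_unique {V : Type} [Fintype V] [DecidableEq V]
    (μ : V → ℝ) (d : V → ℕ) (hgen : IsGenTuple μ d) (hmono : DegMonotone μ d)
    (H H' : DirTree V) (hH : IsHuffmanDir μ d H) (hH' : IsHuffmanDir μ d H') :
    VWWI μ H.toGraph = VWWI μ H'.toGraph := by
  obtain ⟨q, c, hc⟩ := hH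
  obtain ⟨q', c', hc'⟩ := hH'
  obtain rfl : q = q' := hc.card_internal.trans hc'.card_internal.symm
  have hq : 0 < q := hc.card_internal ▸ hgen.one_le_internal
  rw [DirTree.VWWI_toGraph, DirTree.VWWI_toGraph,
    hc.sum_eq hq hgen.deg_pos (fun x => x * ((∑ v, μ v) - x)),
    hc'.sum_eq hq hgen.deg_pos (fun x => x * ((∑ v, μ v) - x))]
  simp only [hc.f_center_eq_f_center hc']
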